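/- arXiv:2302.04322 — 2 statements merged into one kernel-verified Lean document; each statement's English description precedes it below -/
import Mathlib

section
/- If 𝒢 is generalised K-colourable with respect to R (with K and 0 < η < 1 constants) and k = Θ(√n), then the honest provers' states ψ₁ = ((1/√m) Σ_{e=(v₁,v₂)∈E} |e⟩|c(v₁), c(v₂)⟩)^{⊗k} and ψ₂ = ((1/√n) Σ_{v∈V} |v⟩|c(v)⟩)^{⊗k} are accepted in the BellQMA(2) protocol with probability at least 1 − exp(−Ω(√n)). -/
open scoped BigOperators Classical

/-- Amplitude `⟨t | F_K | s⟩` of the quantum Fourier transform on `ℂ^K`. -/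
noncomputable def fourierAmp (K : ℕ) (s t : ℕ) : ℂ :=
  Complex.exp (2 * Real.pi * Complex.I * s * t / K) / Real.sqrt K

/-- Overlap of ψ with the basis vector indexed by `(r, q̄)` used by the uniformity test. -/
noncomputable def unifOverlap (K' Q k : ℕ) (r : Fin k → Fin K') (qbar : Fin k → Fin Q)
    (ψ : (Fin k → Fin Q) → (Fin k → Fin K') → ℂ) : ℂ :=
  ∑ q : Fin k → Fin Q, ∑ a : Fin k → Fin K',
    ψ q a * (∏ i, (starRingEnd ℂ) (fourierAmp K' (r i) (a i)))
      * (∏ i, if (r i : ℕ) = 0 then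
            (starRingEnd ℂ) (fourierAmp Q 0 (q i)) * (if (qbar i : ℕ) = 0 then 1 else 0)
          else (if q i = qbar i then 1 else 0))

/-- Probability that ψ passes the uniformity test with parameters `(K', Q, k, η)`. -/
noncomputable def unifPassProb (K' Q k : ℕ) (η : ℝ)
    (ψ : (Fin k → Fin Q) → (Fin k → Fin K') → ℂ) : ℝ :=
  ∑ r : Fin k → Fin K',
    if ((1 - η) / (K' : ℝ) * k ≤ ((Finset.univ.filter fun i => (r i : ℕ) = 0).card : ℝ)) then
      ∑ qbar : Fin k → Fin Q, Complex.normSq (unifOverlap K' Q k r qbar ψ)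
    else 0

/-- The consistency-test acceptance predicate: for every Alice edge `qA i` and Bob vertex `qB j`
with `qB j ∈ qA i`, Alice's and Bob's colourings of that vertex agree and the colours Alice
assigns to the endpoints of the edge satisfy `R`. -/
def consisAccept {n m K k l : ℕ} (ends : Fin m → Fin n × Fin n)
    (R : Fin m → Fin K → Fin K → Bool)
    (qA : Fin k → Fin m) (qB : Fin l → Fin n)
    (aA : Fin k → Fin K × Fin K) (aB : Fin l → Fin K) : Prop :=
  ∀ (i : Fin k) (j : Fin l),
    (((ends (qA i)).1 = qB j ∨ (ends (qA i)).2 = qB j) →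
        R (qA i) (aA i).1 (aA i).2 = true) ∧
    ((ends (qA i)).1 = qB j → (aA i).1 = aB j) ∧
    ((ends (qA i)).2 = qB j → (aA i).2 = aB j)

/-- Probability that the consistency test accepts `ψ1 ⊗ ψ2` (all registers measured in the
standard basis; Alice's answers are decoded from `Fin (K*K)` into colour pairs). -/
noncomputable def protoConsisPassProb {n m K k : ℕ} (ends : Fin m → Fin n × Fin n)
    (R : Fin m → Fin K → Fin K → Bool)
    (ψ1 : (Fin k → Fin m) → (Fin k → Fin (K * K)) → ℂ)
    (ψ2 : (Fin k → Fin n) → (Fin k → Fin K) → ℂ) : ℝ :=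
  ∑ qA : Fin k → Fin m, ∑ aA : Fin k → Fin (K * K),
    ∑ qB : Fin k → Fin n, ∑ aB : Fin k → Fin K,
      (if consisAccept ends R qA qB (fun i => finProdFinEquiv.symm (aA i)) aB then 1 else 0) *
        Complex.normSq (ψ1 qA aA) * Complex.normSq (ψ2 qB aB)

/-- Acceptance probability of the BellQMA(2) protocol: with probability 1/2 the verifier runs the
uniformity test on `ψ1` (parameters `(K², m, k, η)`) and on `ψ2` (parameters `(K, n, k, η)`),
and with probability 1/2 he runs the consistency test on `ψ1 ⊗ ψ2`. -/
noncomputable def protocolAcceptProb (n m K k : ℕ) (η : ℝ)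
    (ends : Fin m → Fin n × Fin n) (R : Fin m → Fin K → Fin K → Bool)
    (ψ1 : (Fin k → Fin m) → (Fin k → Fin (K * K)) → ℂ)
    (ψ2 : (Fin k → Fin n) → (Fin k → Fin K) → ℂ) : ℝ :=
  (1 / 2) * (unifPassProb (K * K) m k η ψ1 * unifPassProb K n k η ψ2)
    + (1 / 2) * protoConsisPassProb ends R ψ1 ψ2

/-- The honest Alice state `((1/√m) Σ_{e=(v₁,v₂)∈E} |e⟩|c(v₁),c(v₂)⟩)^{⊗k}`. -/
noncomputable def honestAlice (n m K k : ℕ) (ends : Fin m → Fin n × Fin n) (c : Fin n → Fin K) :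
    (Fin k → Fin m) → (Fin k → Fin (K * K)) → ℂ :=
  fun q a => ∏ i, ((Real.sqrt m : ℂ))⁻¹ *
    (if a i = finProdFinEquiv (c (ends (q i)).1, c (ends (q i)).2) then 1 else 0)

/-- The honest Bob state `((1/√n) Σ_{v∈V} |v⟩|c(v)⟩)^{⊗k}`. -/
noncomputable def honestBob (n K k : ℕ) (c : Fin n → Fin K) :
    (Fin k → Fin n) → (Fin k → Fin K) → ℂ :=
  fun q a => ∏ i, ((Real.sqrt n : ℂ))⁻¹ * (if a i = c (q i) then 1 else 0)

/-- The `k`-fold tensor power of `(1/√Q) Σ_q |q⟩|f q⟩`. -/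
noncomputable def honestState (K' Q k : ℕ) (f : Fin Q → Fin K') :
    (Fin k → Fin Q) → (Fin k → Fin K') → ℂ :=
  fun q a => ∏ i, ((Real.sqrt Q : ℂ))⁻¹ * (if a i = f (q i) then 1 else 0)

theorem sum_pi_prod {R ι : Type*} [CommSemiring R] {k : ℕ} [Fintype ι] (g : Fin k → ι → R) :
    ∑ x : Fin k → ι, ∏ i, g i (x i) = ∏ i, ∑ j, g i j := by
  rw [Finset.prod_univ_sum, Fintype.piFinset_univ]

theorem sum_pi_sum_pi_prod {R ι κ : Type*} [CommSemiring R] {k : ℕ} [Fintype ι] [Fintype κ]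
    (g : Fin k → ι → κ → R) :
    ∑ x : Fin k → ι, ∑ y : Fin k → κ, ∏ i, g i (x i) (y i) = ∏ i, ∑ a, ∑ b, g i a b := by
  rw [← sum_pi_prod (fun i a => ∑ b, g i a b)]
  exact Finset.sum_congr rfl fun x _ => sum_pi_prod (fun i b => g i (x i) b)

theorem normSq_inv_sqrt_natCast (Q : ℕ) :
    Complex.normSq ((Real.sqrt Q : ℂ))⁻¹ = (Q : ℝ)⁻¹ := by
  rw [Complex.normSq_inv, Complex.normSq_ofReal, Real.mul_self_sqrt (Nat.cast_nonneg Q)]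

theorem normSq_fourierAmp (K s t : ℕ) : Complex.normSq (fourierAmp K s t) = (K : ℝ)⁻¹ := by
  have h : (2 * Real.pi * Complex.I * s * t / K : ℂ)
      = ((2 * Real.pi * s * t / K : ℝ) : ℂ) * Complex.I := by
    push_cast; ring
  rw [fourierAmp, h, div_eq_mul_inv, Complex.normSq_mul, normSq_inv_sqrt_natCast,
    Complex.normSq_eq_norm_sq, Complex.norm_exp_ofReal_mul_I]
  simp

theorem fourierAmp_zero_left (K t : ℕ) : fourierAmp K 0 t = ((Real.sqrt K : ℂ))⁻¹ := by
  simp [fourierAmp]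

theorem sum_sum_normSq_honestState (K' Q k : ℕ) (hQ : 0 < Q) (f : Fin Q → Fin K') :
    ∑ q, ∑ a, Complex.normSq (honestState K' Q k f q a) = 1 := by
  have hQ' : (Q : ℝ) ≠ 0 := by positivity
  have h : ∀ q : Fin Q, ∑ a : Fin K', Complex.normSq
      (((Real.sqrt Q : ℂ))⁻¹ * (if a = f q then 1 else 0)) = (Q : ℝ)⁻¹ := by
    intro q
    rw [Finset.sum_eq_single (f q)]
    · rw [if_pos rfl, mul_one, normSq_inv_sqrt_natCast]
    · intro b _ hb
      simp [hb]
    · simp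
  simp only [honestState, map_prod]
  rw [sum_pi_sum_pi_prod (fun _ q a => Complex.normSq
      (((Real.sqrt Q : ℂ))⁻¹ * (if a = f q then 1 else 0)))]
  simp only [h]
  simp [hQ']

/-- Single-register overlap of the honest state in the uniformity test. -/
noncomputable def registerOverlap (K' Q : ℕ) (f : Fin Q → Fin K') (s : Fin K') (t : Fin Q) : ℂ :=
  ∑ q : Fin Q, ∑ a : Fin K',
    ((Real.sqrt Q : ℂ))⁻¹ * (if a = f q then 1 else 0) * (starRingEnd ℂ) (fourierAmp K' s a)
      * (if (s : ℕ) = 0 then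
          (starRingEnd ℂ) (fourierAmp Q 0 q) * (if (t : ℕ) = 0 then 1 else 0)
        else (if q = t then 1 else 0))

theorem unifOverlap_honestState (K' Q k : ℕ) (f : Fin Q → Fin K')
    (r : Fin k → Fin K') (t : Fin k → Fin Q) :
    unifOverlap K' Q k r t (honestState K' Q k f)
      = ∏ i, registerOverlap K' Q f (r i) (t i) := by
  simp only [unifOverlap, honestState, registerOverlap, ← Finset.prod_mul_distrib]
  exact sum_pi_sum_pi_prod (fun i q a =>
    ((Real.sqrt Q : ℂ))⁻¹ * (if a = f q then 1 else 0) * (starRingEnd ℂ) (fourierAmp K' (r i) a)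
      * (if (r i : ℕ) = 0 then
          (starRingEnd ℂ) (fourierAmp Q 0 q) * (if (t i : ℕ) = 0 then 1 else 0)
        else (if q = t i then 1 else 0)))

theorem registerOverlap_eq (K' Q : ℕ) (f : Fin Q → Fin K') (s : Fin K') (t : Fin Q) :
    registerOverlap K' Q f s t = ∑ q : Fin Q,
      ((Real.sqrt Q : ℂ))⁻¹ * (starRingEnd ℂ) (fourierAmp K' s (f q))
      * (if (s : ℕ) = 0 then
          (starRingEnd ℂ) (fourierAmp Q 0 q) * (if (t : ℕ) = 0 then 1 else 0)
        else (if q = t then 1 else 0)) := by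
  refine Finset.sum_congr rfl fun q _ => ?_
  rw [Finset.sum_eq_single (f q)]
  · rw [if_pos rfl, mul_one]
  · intro b _ hb
    rw [if_neg hb]; ring
  · simp

theorem sum_normSq_registerOverlap (K' Q : ℕ) (hQ : 0 < Q) (f : Fin Q → Fin K') (s : Fin K') :
    ∑ t, Complex.normSq (registerOverlap K' Q f s t) = (K' : ℝ)⁻¹ := by
  have hQ' : (Q : ℝ) ≠ 0 := by positivity
  have hQc : (Q : ℂ) ≠ 0 := by exact_mod_cast hQ.ne'
  by_cases hs : (s : ℕ) = 0
  · have h : ∀ t, registerOverlap K' Q f s t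
        = ((Real.sqrt K' : ℂ))⁻¹ * (if t = (⟨0, hQ⟩ : Fin Q) then 1 else 0) := by
      intro t
      have hsq : ((Real.sqrt Q : ℂ))⁻¹ * ((Real.sqrt Q : ℂ))⁻¹ = (Q : ℂ)⁻¹ := by
        rw [← mul_inv, ← Complex.ofReal_mul, Real.mul_self_sqrt (Nat.cast_nonneg Q)]
        simp
      have ht : (t : ℕ) = 0 ↔ t = (⟨0, hQ⟩ : Fin Q) := by simp [Fin.ext_iff]
      simp only [registerOverlap_eq, hs, if_true, fourierAmp_zero_left, map_inv₀,
        Complex.conj_ofReal, Finset.sum_const, Finset.card_univ, Fintype.card_fin, nsmul_eq_mul, ht]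
      rw [show ∀ x y z w : ℂ, w * (x * y * (x * z)) = w * (x * x) * (y * z) by intros; ring,
        hsq, mul_inv_cancel₀ hQc, one_mul]
    simp only [h]
    rw [Finset.sum_eq_single (⟨0, hQ⟩ : Fin Q)]
    · rw [if_pos rfl, mul_one, normSq_inv_sqrt_natCast]
    · intro b _ hb
      simp [hb]
    · simp
  · have h : ∀ t, Complex.normSq (registerOverlap K' Q f s t) = (Q : ℝ)⁻¹ * (K' : ℝ)⁻¹ := by
      intro t
      rw [registerOverlap_eq, Finset.sum_eq_single t]
      · simp only [hs, if_false, if_true, mul_one]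
        rw [Complex.normSq_mul, normSq_inv_sqrt_natCast, Complex.normSq_conj, normSq_fourierAmp]
      · intro b _ hb
        simp [hs, hb]
      · simp
    simp only [h, Finset.sum_const, Finset.card_univ, Fintype.card_fin, nsmul_eq_mul]
    rw [← mul_assoc, mul_inv_cancel₀ hQ', one_mul]

theorem sum_normSq_unifOverlap_honestState (K' Q k : ℕ) (hQ : 0 < Q) (f : Fin Q → Fin K')
    (r : Fin k → Fin K') :
    ∑ t, Complex.normSq (unifOverlap K' Q k r t (honestState K' Q k f)) = ((K' : ℝ)⁻¹) ^ k := by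
  simp only [unifOverlap_honestState, map_prod]
  rw [sum_pi_prod (fun i t => Complex.normSq (registerOverlap K' Q f (r i) t))]
  simp only [sum_normSq_registerOverlap K' Q hQ f]
  simp

/-- Exponential moment of the number of zeros of a uniformly random word. -/
theorem sum_exp_neg_card_zeros (K' k : ℕ) (hK : 0 < K') (l : ℝ) :
    ∑ r : Fin k → Fin K', ((K' : ℝ)⁻¹) ^ k *
        Real.exp (-l * ((Finset.univ.filter fun i => (r i : ℕ) = 0).card : ℝ))
      = (1 + (Real.exp (-l) - 1) / K') ^ k := by
  have hK' : (K' : ℝ) ≠ 0 := by positivity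
  have h : ∀ r : Fin k → Fin K', ((K' : ℝ)⁻¹) ^ k *
        Real.exp (-l * ((Finset.univ.filter fun i => (r i : ℕ) = 0).card : ℝ))
      = ∏ i, (K' : ℝ)⁻¹ * (1 + if r i = (⟨0, hK⟩ : Fin K') then Real.exp (-l) - 1 else 0) := by
    intro r
    rw [Finset.prod_mul_distrib, Finset.prod_const, Finset.card_univ, Fintype.card_fin,
      mul_comm (-l), Real.exp_nat_mul, Finset.card_filter, ← Finset.prod_pow_eq_pow_sum]
    congr 1
    refine Finset.prod_congr rfl fun i _ => ?_
    by_cases hi : (r i : ℕ) = 0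
    · have : r i = (⟨0, hK⟩ : Fin K') := Fin.ext hi
      simp [this]
    · have : r i ≠ (⟨0, hK⟩ : Fin K') := fun e => hi (by rw [e])
      simp [this, hi]
  simp only [h]
  rw [sum_pi_prod (fun _ s => (K' : ℝ)⁻¹ * (1 + if s = (⟨0, hK⟩ : Fin K')
    then Real.exp (-l) - 1 else 0))]
  simp only [← Finset.mul_sum, Finset.sum_add_distrib, Finset.sum_ite_eq', Finset.mem_univ,
    if_true, Finset.prod_const, Finset.card_univ, Fintype.card_fin, Finset.sum_const,
    nsmul_eq_mul, mul_one]
  congr 1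
  field_simp

theorem one_sub_exp_le_unifPassProb_honestState (K' Q k : ℕ) (hK : 0 < K') (hQ : 0 < Q) (η : ℝ)
    (hη0 : 0 < η) (hη1 : η < 1) (f : Fin Q → Fin K') :
    1 - Real.exp (-(η ^ 2 / 4 * (k / K'))) ≤ unifPassProb K' Q k η (honestState K' Q k f) := by
  have hK' : (0 : ℝ) < K' := by positivity
  set N : (Fin k → Fin K') → ℝ :=
    fun r => ((Finset.univ.filter fun i => (r i : ℕ) = 0).card : ℝ) with hN
  set T : ℝ := (1 - η) / (K' : ℝ) * k with hT
  have hpos : 0 ≤ ((K' : ℝ)⁻¹) ^ k := by positivity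
  have hbase : ∑ _r : Fin k → Fin K', ((K' : ℝ)⁻¹) ^ k = 1 := by
    simp [hK'.ne']
  have hlower : 1 - ∑ r : Fin k → Fin K',
        Real.exp (η / 2 * T) * (((K' : ℝ)⁻¹) ^ k * Real.exp (-(η / 2) * N r))
      ≤ unifPassProb K' Q k η (honestState K' Q k f) := by
    simp only [unifPassProb, sum_normSq_unifOverlap_honestState K' Q k hQ f]
    refine le_trans (le_of_eq (b := ∑ r, (((K' : ℝ)⁻¹) ^ k -
      Real.exp (η / 2 * T) * (((K' : ℝ)⁻¹) ^ k * Real.exp (-(η / 2) * N r))))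
      (by rw [Finset.sum_sub_distrib, hbase])) ?_
    refine Finset.sum_le_sum fun r _ => ?_
    split_ifs with hr
    · have : 0 ≤ Real.exp (η / 2 * T) * (((K' : ℝ)⁻¹) ^ k * Real.exp (-(η / 2) * N r)) := by
        positivity
      linarith
    · have hlt : N r < T := not_le.mp hr
      have h1 : 1 ≤ Real.exp (η / 2 * T) * Real.exp (-(η / 2) * N r) := by
        rw [← Real.exp_add]
        refine Real.one_le_exp ?_
        nlinarith
      nlinarith [mul_le_mul_of_nonneg_left h1 hpos]
  rw [← Finset.mul_sum, sum_exp_neg_card_zeros K' k hK] at hlower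
  refine le_trans (sub_le_sub_left ?_ 1) hlower
  have hquad : Real.exp (-(η / 2)) - 1 ≤ -(η / 2) + (η / 2) ^ 2 := by
    have h := Real.abs_exp_sub_one_sub_id_le (x := -(η / 2)) (by
      rw [abs_neg, abs_of_pos (by linarith)]; linarith)
    have h' := (abs_le.mp h).2
    nlinarith
  have hb0 : 0 ≤ 1 + (Real.exp (-(η / 2)) - 1) / K' := by
    have h1 : (1 : ℝ) ≤ K' := by exact_mod_cast hK
    have h2 : -1 ≤ (Real.exp (-(η / 2)) - 1) / K' := by
      rw [le_div_iff₀ hK']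
      nlinarith [Real.exp_pos (-(η / 2))]
    linarith
  have hb : 1 + (Real.exp (-(η / 2)) - 1) / K' ≤ Real.exp ((-(η / 2) + (η / 2) ^ 2) / K') := by
    have h1 : (Real.exp (-(η / 2)) - 1) / K' ≤ (-(η / 2) + (η / 2) ^ 2) / K' := by gcongr
    linarith [Real.add_one_le_exp ((-(η / 2) + (η / 2) ^ 2) / K')]
  calc Real.exp (η / 2 * T) * (1 + (Real.exp (-(η / 2)) - 1) / K') ^ k
      ≤ Real.exp (η / 2 * T) * Real.exp ((-(η / 2) + (η / 2) ^ 2) / K') ^ k := by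
        gcongr
    _ = Real.exp (-(η ^ 2 / 4 * (k / K'))) := by
        rw [← Real.exp_nat_mul, ← Real.exp_add, hT]
        congr 1
        field_simp
        ring

theorem protoConsisPassProb_honestState {n m K k : ℕ} (hn : 0 < n) (hm : 0 < m)
    (ends : Fin m → Fin n × Fin n) (R : Fin m → Fin K → Fin K → Bool) (c : Fin n → Fin K)
    (hc : ∀ e : Fin m, R e (c (ends e).1) (c (ends e).2) = true) :
    protoConsisPassProb ends R
      (honestState (K * K) m k fun e => finProdFinEquiv (c (ends e).1, c (ends e).2))
      (honestState K n k c) = 1 := by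
  set f : Fin m → Fin (K * K) := fun e => finProdFinEquiv (c (ends e).1, c (ends e).2) with hf
  have hsupp : ∀ {L Q : ℕ} (g : Fin Q → Fin L) (q : Fin k → Fin Q) (a : Fin k → Fin L),
      Complex.normSq (honestState L Q k g q a) ≠ 0 → ∀ i, a i = g (q i) := by
    intro L Q g q a h i
    by_contra hi
    refine h ?_
    rw [Complex.normSq_eq_zero, honestState]
    exact Finset.prod_eq_zero (Finset.mem_univ i) (by rw [if_neg hi, mul_zero])
  have hterm : ∀ qA aA qB aB,
      (if consisAccept ends R qA qB (fun i => finProdFinEquiv.symm (aA i)) aB then (1 : ℝ) else 0)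
        * Complex.normSq (honestState (K * K) m k f qA aA)
        * Complex.normSq (honestState K n k c qB aB)
      = Complex.normSq (honestState (K * K) m k f qA aA)
        * Complex.normSq (honestState K n k c qB aB) := by
    intro qA aA qB aB
    by_cases h1 : Complex.normSq (honestState (K * K) m k f qA aA) = 0
    · rw [h1]; ring
    by_cases h2 : Complex.normSq (honestState K n k c qB aB) = 0
    · rw [h2]; ring
    have hA := hsupp f qA aA h1
    have hB := hsupp c qB aB h2
    rw [if_pos, one_mul]
    intro i j
    have hAi : finProdFinEquiv.symm (aA i) = (c (ends (qA i)).1, c (ends (qA i)).2) := by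
      rw [hA i, hf, Equiv.symm_apply_apply]
    simp only [hAi, hB j]
    exact ⟨fun _ => hc (qA i), fun h => by rw [h], fun h => by rw [h]⟩
  simp only [protoConsisPassProb, hterm, ← Finset.mul_sum]
  rw [sum_sum_normSq_honestState K n k hn c]
  simp only [mul_one]
  exact sum_sum_normSq_honestState (K * K) m k hm f

/-- completeness of the BellQMA(2) protocol. For constant `K`, constant
`0 < η < 1` and `k = Θ(√n)` (i.e. `α√n ≤ k ≤ β√n` for constants `0 < α ≤ β`), if `𝒢` is
generalised `K`-colourable with respect to `R` via a colouring `c`, then the honest provers'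
states are accepted with probability at least `1 - exp(-Ω(√n))`. -/
theorem bellqma_completeness
    (K : ℕ) (hK : 0 < K) (η : ℝ) (hη0 : 0 < η) (hη1 : η < 1)
    (α β : ℝ) (hα : 0 < α) (hαβ : α ≤ β) :
    ∃ (cst : ℝ) (n₀ : ℕ), 0 < cst ∧
      ∀ n : ℕ, n₀ ≤ n →
      ∀ (m : ℕ), 0 < m →
      ∀ (ends : Fin m → Fin n × Fin n) (R : Fin m → Fin K → Fin K → Bool)
        (c : Fin n → Fin K),
        (∀ e : Fin m, R e (c (ends e).1) (c (ends e).2) = true) →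
      ∀ k : ℕ, α * Real.sqrt n ≤ (k : ℝ) → (k : ℝ) ≤ β * Real.sqrt n →
        1 - Real.exp (-(cst * Real.sqrt n)) ≤
          protocolAcceptProb n m K k η ends R
            (honestAlice n m K k ends c) (honestBob n K k c) := by
  refine ⟨η ^ 2 / 4 * α / ((K * K : ℕ) : ℝ), 0, by positivity, ?_⟩
  intro n _ m hm ends R c hc k hk _
  have hn : 0 < n := (ends ⟨0, hm⟩).1.pos
  have hKK : 0 < K * K := Nat.mul_pos hK hK
  have hA := one_sub_exp_le_unifPassProb_honestState (K * K) m k hKK hm η hη0 hη1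
    fun e => finProdFinEquiv (c (ends e).1, c (ends e).2)
  have hB := one_sub_exp_le_unifPassProb_honestState K n k hK hn η hη0 hη1 c
  have hC := protoConsisPassProb_honestState (k := k) hn hm ends R c hc
  change _ ≤ protocolAcceptProb n m K k η ends R
    (honestState (K * K) m k fun e => finProdFinEquiv (c (ends e).1, c (ends e).2))
    (honestState K n k c)
  rw [protocolAcceptProb, hC]
  set δ := Real.exp (-(η ^ 2 / 4 * α / ((K * K : ℕ) : ℝ) * Real.sqrt n)) with hδ
  have hδ0 : 0 ≤ δ := (Real.exp_pos _).le
  have hδ1 : δ ≤ 1 := Real.exp_le_one_iff.mpr (neg_nonpos.mpr (by positivity))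
  have hbound : ∀ L : ℕ, 0 < L → L ≤ K * K →
      Real.exp (-(η ^ 2 / 4 * (k / (L : ℝ)))) ≤ δ := by
    intro L hL hLK
    refine Real.exp_le_exp.mpr (neg_le_neg ?_)
    calc η ^ 2 / 4 * α / ((K * K : ℕ) : ℝ) * Real.sqrt n
        = η ^ 2 / 4 * (α * Real.sqrt n / ((K * K : ℕ) : ℝ)) := by ring
      _ ≤ η ^ 2 / 4 * (k / (L : ℝ)) := by gcongr
  have hA' := hbound (K * K) hKK le_rfl
  have hB' := hbound K hK (Nat.le_mul_of_pos_left K hK)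
  have hprod := mul_le_mul ((sub_le_sub_left hA' 1).trans hA) ((sub_le_sub_left hB' 1).trans hB)
    (sub_nonneg.mpr hδ1) ((sub_nonneg.mpr hδ1).trans ((sub_le_sub_left hA' 1).trans hA))
  nlinarith [sq_nonneg δ]
end

section
/- Let (𝒢, K, R) be an instance of δ-GAP-KCOL and suppose the pair of states ψ₁, ψ₂ is accepted in the BellQMA(2) protocol with probability at least 1 − ε. Then there exists a randomized classical strategy for the consistency game G^{k',k'}(𝒢, K, R), with k' = (k/K')(1−η), achieving value at least 1 − O(ε^{1/4}). -/
open scoped BigOperators Classical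

/-- The payoff of the deterministic strategy `(f, g)` in the two-player game with question
distribution `μ` and decision predicate `D`. -/
noncomputable def stratValue {X Y A B : Type*} [Fintype X] [Fintype Y]
    (μ : X → Y → ℝ) (D : X → Y → A → B → Prop)
    (f : X → A) (g : Y → B) : ℝ :=
  ∑ x : X, ∑ y : Y, μ x y * (if D x y (f x) (g y) then 1 else 0)

/-- The uniform distribution over pairs of questions. -/
noncomputable def uniformPair (X Y : Type*) [Fintype X] [Fintype Y] : X → Y → ℝ :=
  fun _ _ => ((Fintype.card X : ℝ) * (Fintype.card Y : ℝ))⁻¹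

section L2

open Matrix

lemma sum_normSq_eq_re_dotProduct {X : Type*} [Fintype X] (u : X → ℂ) :
    ∑ x, Complex.normSq (u x) = (star u ⬝ᵥ u).re := by
  simp [dotProduct, Complex.re_sum, Complex.normSq_apply]

lemma star_mulVec_dotProduct_mulVec {X Y : Type*} [Fintype X] [Fintype Y]
    (A : Matrix Y X ℂ) (u : X → ℂ) :
    star (A *ᵥ u) ⬝ᵥ (A *ᵥ u) = star u ⬝ᵥ ((Aᴴ * A) *ᵥ u) := by
  rw [star_mulVec, ← dotProduct_mulVec, mulVec_mulVec]

/-- An isometry preserves the sum of squared moduli. -/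
lemma sum_normSq_mulVec_of_isometry {X Y : Type*} [Fintype X] [Fintype Y] [DecidableEq X]
    {A : Matrix Y X ℂ} (hA : Aᴴ * A = 1) (u : X → ℂ) :
    ∑ y, Complex.normSq ((A *ᵥ u) y) = ∑ x, Complex.normSq (u x) := by
  rw [sum_normSq_eq_re_dotProduct, star_mulVec_dotProduct_mulVec, hA, one_mulVec,
    sum_normSq_eq_re_dotProduct]

lemma sum_normSq_mulVec_of_partialIsometry {X Y : Type*} [Fintype X] [Fintype Y]
    {A : Matrix Y X ℂ} {P : Matrix X X ℂ} (hA : Aᴴ * A = P) (hP : P * P = P) (u : X → ℂ) :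
    ∑ x, Complex.normSq ((P *ᵥ u) x) = ∑ y, Complex.normSq ((A *ᵥ u) y) := by
  have hH : Pᴴ = P := by rw [← hA]; simp
  rw [sum_normSq_eq_re_dotProduct, sum_normSq_eq_re_dotProduct, star_mulVec_dotProduct_mulVec,
    star_mulVec_dotProduct_mulVec, hH, hP, hA]

/-- Pythagoras for the initial projection `P = Aᴴ A` of a partial isometry `A`. -/
lemma sum_normSq_sub_mulVec_of_partialIsometry {X Y : Type*} [Fintype X] [Fintype Y]
    {A : Matrix Y X ℂ} {P : Matrix X X ℂ} (hA : Aᴴ * A = P) (hP : P * P = P) (u : X → ℂ) :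
    ∑ x, Complex.normSq (u x - (P *ᵥ u) x) =
      ∑ x, Complex.normSq (u x) - ∑ y, Complex.normSq ((A *ᵥ u) y) := by
  have hH : Pᴴ = P := by rw [← hA]; simp
  have h1 : star (P *ᵥ u) ⬝ᵥ u = star u ⬝ᵥ (P *ᵥ u) := by
    rw [star_mulVec, hH, ← dotProduct_mulVec]
  have h2 : star (P *ᵥ u) ⬝ᵥ (P *ᵥ u) = star u ⬝ᵥ (P *ᵥ u) := by
    rw [star_mulVec_dotProduct_mulVec, hH, hP]
  have h := sum_normSq_eq_re_dotProduct (u - P *ᵥ u)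
  simp only [Pi.sub_apply] at h
  rw [h, sum_normSq_eq_re_dotProduct u, sum_normSq_eq_re_dotProduct (A *ᵥ u),
    star_mulVec_dotProduct_mulVec, hA, star_sub, sub_dotProduct, dotProduct_sub, dotProduct_sub,
    h1, h2]
  simp

end L2

lemma sum_abs_normSq_sub_le {X : Type*} [Fintype X] (u v : X → ℂ)
    (hu : ∑ x, Complex.normSq (u x) ≤ 1) (hv : ∑ x, Complex.normSq (v x) ≤ 1) :
    ∑ x, |Complex.normSq (u x) - Complex.normSq (v x)| ≤
      2 * √(∑ x, Complex.normSq (u x - v x)) := by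
  have key : ∀ x, |Complex.normSq (u x) - Complex.normSq (v x)| ≤
      ‖u x - v x‖ * (‖u x‖ + ‖v x‖) := fun x => by
    rw [Complex.normSq_eq_norm_sq, Complex.normSq_eq_norm_sq, sq_sub_sq, abs_mul, mul_comm,
      abs_of_nonneg (by positivity : 0 ≤ ‖u x‖ + ‖v x‖)]
    exact mul_le_mul_of_nonneg_right (abs_norm_sub_norm_le _ _) (by positivity)
  have h4 : ∑ x, (‖u x‖ + ‖v x‖) ^ 2 ≤ 2 ^ 2 := by
    calc ∑ x, (‖u x‖ + ‖v x‖) ^ 2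
        ≤ ∑ x, (2 * Complex.normSq (u x) + 2 * Complex.normSq (v x)) := by
          refine Finset.sum_le_sum fun x _ => ?_
          rw [Complex.normSq_eq_norm_sq, Complex.normSq_eq_norm_sq]
          nlinarith [sq_nonneg (‖u x‖ - ‖v x‖)]
      _ ≤ 2 ^ 2 := by
          rw [Finset.sum_add_distrib, ← Finset.mul_sum, ← Finset.mul_sum]; linarith
  calc _ ≤ ∑ x, ‖u x - v x‖ * (‖u x‖ + ‖v x‖) := Finset.sum_le_sum fun x _ => key x
    _ ≤ √(∑ x, ‖u x - v x‖ ^ 2) * √(∑ x, (‖u x‖ + ‖v x‖) ^ 2) :=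
        Real.sum_mul_le_sqrt_mul_sqrt _ _ _
    _ ≤ √(∑ x, ‖u x - v x‖ ^ 2) * 2 := by
        gcongr
        exact Real.sqrt_le_iff.2 ⟨by norm_num, h4⟩
    _ = _ := by rw [mul_comm]; simp only [Complex.normSq_eq_norm_sq]

lemma sum_fourierAmp_mul_conj (K : ℕ) (hK : 0 < K) (a b : Fin K) :
    ∑ r : Fin K, fourierAmp K r a * (starRingEnd ℂ) (fourierAmp K r b) =
      if a = b then 1 else 0 := by
  have hK0 : (K : ℂ) ≠ 0 := by exact_mod_cast hK.ne'
  set z : ℂ := Complex.exp (2 * Real.pi * Complex.I * ((a : ℂ) - b) / K) with hz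
  have hterm : ∀ r : Fin K, fourierAmp K r a * (starRingEnd ℂ) (fourierAmp K r b) =
      z ^ (r : ℕ) / K := fun r => by
    have hs : ((√(K : ℝ) : ℝ) : ℂ) * ((√(K : ℝ) : ℝ) : ℂ) = K := by
      rw [← Complex.ofReal_mul, Real.mul_self_sqrt (Nat.cast_nonneg K)]; simp
    unfold fourierAmp
    rw [map_div₀, ← Complex.exp_conj, div_mul_div_comm, Complex.conj_ofReal, hs, ← Complex.exp_add,
      hz, ← Complex.exp_nat_mul]
    congr 2
    simp only [map_div₀, map_mul, Complex.conj_ofReal, Complex.conj_I, map_natCast, map_ofNat]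
    ring
  rw [Finset.sum_congr rfl fun r _ => hterm r, ← Finset.sum_div,
    Fin.sum_univ_eq_sum_range (fun i => z ^ i) K]
  split_ifs with h
  · have : z = 1 := by simp [hz, h]
    simp [this, hK0]
  · have hz1 : z ≠ 1 := by
      intro h1
      obtain ⟨N, hN⟩ := Complex.exp_eq_one_iff.1 h1
      have hpi : (2 * Real.pi * Complex.I : ℂ) ≠ 0 := Complex.two_pi_I_ne_zero
      have h2 : (a : ℂ) - b = N * K := by
        field_simp at hN
        linear_combination hN
      have h3 : ((a : ℕ) : ℤ) - (b : ℕ) = N * K := by exact_mod_cast h2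
      have ha := a.2
      have hb := b.2
      have hN0 : N = 0 := by
        by_contra hne
        rcases lt_or_gt_of_ne hne with h' | h' <;> nlinarith
      apply h
      ext
      subst hN0
      omega
    have hzK : z ^ K = 1 := by
      rw [hz, ← Complex.exp_nat_mul, Complex.exp_eq_one_iff]
      refine ⟨(a : ℤ) - (b : ℤ), ?_⟩
      push_cast
      field_simp
    rw [geom_sum_eq hz1, hzK]
    simp

/-- The adjoint Fourier transform on all answer registers. -/
noncomputable def fourierMatrix (K k : ℕ) : Matrix (Fin k → Fin K) (Fin k → Fin K) ℂ :=
  Matrix.of fun r a => ∏ i, (starRingEnd ℂ) (fourierAmp K (r i) (a i))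

open Matrix in
lemma fourierMatrix_isometry (K k : ℕ) (hK : 0 < K) :
    (fourierMatrix K k)ᴴ * fourierMatrix K k = 1 := by
  ext a b
  rw [Matrix.mul_apply, Matrix.one_apply]
  simp only [fourierMatrix, conjTranspose_apply, of_apply, star_prod, ← Finset.prod_mul_distrib]
  rw [← Fintype.prod_sum (fun i (r : Fin K) =>
    star ((starRingEnd ℂ) (fourierAmp K r (a i))) * (starRingEnd ℂ) (fourierAmp K r (b i)))]
  simp only [RCLike.star_def, Complex.conj_conj, sum_fourierAmp_mul_conj K hK,
    Finset.prod_ite_zero, Finset.prod_const_one, Finset.mem_univ, true_imp_iff, funext_iff]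

/-- The question-register part of the uniformity test for Fourier outcome `r`. -/
noncomputable def testMatrix (K Q k : ℕ) (r : Fin k → Fin K) :
    Matrix (Fin k → Fin Q) (Fin k → Fin Q) ℂ :=
  Matrix.of fun qbar q => ∏ i, if (r i : ℕ) = 0 then
      (starRingEnd ℂ) (fourierAmp Q 0 (q i)) * (if (qbar i : ℕ) = 0 then 1 else 0)
    else (if q i = qbar i then 1 else 0)

/-- Projection onto the uniform superposition on the question registers where `r` vanishes. -/
noncomputable def unifProj (K Q k : ℕ) (r : Fin k → Fin K) :
    Matrix (Fin k → Fin Q) (Fin k → Fin Q) ℂ :=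
  Matrix.of fun q q' => ∏ i, if (r i : ℕ) = 0 then (Q : ℂ)⁻¹ else (if q i = q' i then 1 else 0)

lemma unifOverlap_eq (K Q k : ℕ) (r : Fin k → Fin K) (qbar : Fin k → Fin Q)
    (ψ : (Fin k → Fin Q) → (Fin k → Fin K) → ℂ) :
    unifOverlap K Q k r qbar ψ =
      (testMatrix K Q k r).mulVec (fun q => (fourierMatrix K k).mulVec (ψ q) r) qbar := by
  simp only [unifOverlap, Matrix.mulVec, dotProduct, testMatrix, fourierMatrix, Matrix.of_apply,
    Finset.mul_sum]
  exact Finset.sum_congr rfl fun q _ => Finset.sum_congr rfl fun a _ => by ring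

open Matrix in
lemma testMatrix_mul (K Q k : ℕ) (hQ : 0 < Q) (r : Fin k → Fin K) :
    (testMatrix K Q k r)ᴴ * testMatrix K Q k r = unifProj K Q k r := by
  ext q q'
  rw [Matrix.mul_apply]
  simp only [testMatrix, unifProj, conjTranspose_apply, of_apply, star_prod,
    ← Finset.prod_mul_distrib]
  rw [← Fintype.prod_sum (fun i (c : Fin Q) =>
    star (if (r i : ℕ) = 0 then
      (starRingEnd ℂ) (fourierAmp Q 0 (q i)) * (if (c : ℕ) = 0 then 1 else 0)
    else (if q i = c then 1 else 0)) * (if (r i : ℕ) = 0 then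
      (starRingEnd ℂ) (fourierAmp Q 0 (q' i)) * (if (c : ℕ) = 0 then 1 else 0)
    else (if q' i = c then 1 else 0)))]
  refine Finset.prod_congr rfl fun i _ => ?_
  have hs : ((√(Q : ℝ) : ℝ) : ℂ) * ((√(Q : ℝ) : ℝ) : ℂ) = Q := by
    rw [← Complex.ofReal_mul, Real.mul_self_sqrt (Nat.cast_nonneg Q)]; simp
  split_ifs with h h'
  · rw [Finset.sum_eq_single (⟨0, hQ⟩ : Fin Q)]
    · simp [fourierAmp, ← mul_inv, hs]
    · intro c _ hc
      have : (c : ℕ) ≠ 0 := fun h0 => hc (Fin.ext h0)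
      simp [this]
    · simp
  · rw [Finset.sum_eq_single (q i)] <;> simp +contextual [h', eq_comm]
  · refine Finset.sum_eq_zero fun c _ => ?_
    by_cases h1 : q i = c
    · have : q' i ≠ c := fun h2 => h' (h1.trans h2.symm)
      simp [this]
    · simp [h1]

lemma unifProj_mul_self (K Q k : ℕ) (hQ : 0 < Q) (r : Fin k → Fin K) :
    unifProj K Q k r * unifProj K Q k r = unifProj K Q k r := by
  have hQ0 : (Q : ℂ) ≠ 0 := by exact_mod_cast hQ.ne'
  ext q q'
  rw [Matrix.mul_apply]
  simp only [unifProj, Matrix.of_apply, ← Finset.prod_mul_distrib]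
  rw [← Fintype.prod_sum (fun i (c : Fin Q) =>
    (if (r i : ℕ) = 0 then (Q : ℂ)⁻¹ else (if q i = c then 1 else 0)) *
      (if (r i : ℕ) = 0 then (Q : ℂ)⁻¹ else (if c = q' i then 1 else 0)))]
  refine Finset.prod_congr rfl fun i _ => ?_
  split_ifs <;> simp_all

lemma unifProj_mulVec_congr (K Q k : ℕ) (r : Fin k → Fin K) (u : (Fin k → Fin Q) → ℂ)
    {q q' : Fin k → Fin Q} (h : ∀ i, (r i : ℕ) ≠ 0 → q i = q' i) :
    (unifProj K Q k r).mulVec u q = (unifProj K Q k r).mulVec u q' := by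
  simp only [Matrix.mulVec, dotProduct, unifProj, Matrix.of_apply]
  refine Finset.sum_congr rfl fun c _ => ?_
  congr 1
  refine Finset.prod_congr rfl fun i _ => ?_
  split_ifs <;> simp_all

/-- A function not depending on the coordinates in the range of the injection `s` has equal mass
on all fibres of restriction along `s`. -/
lemma sum_fiber_eq {Q k k' : ℕ} (hQ : 0 < Q) (s : Fin k' → Fin k) (hs : Function.Injective s)
    (U : (Fin k → Fin Q) → ℝ)
    (hU : ∀ q q', (∀ i, i ∉ Set.range s → q i = q' i) → U q = U q') (x : Fin k' → Fin Q) :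
    ∑ q, (if q ∘ s = x then U q else 0) = ((Q : ℝ) ^ k')⁻¹ * ∑ q, U q := by
  have : NeZero Q := ⟨hQ.ne'⟩
  have hconst : ∀ y, ∑ q, (if q ∘ s = y then U q else 0) =
      ∑ q, (if q ∘ s = x then U q else 0) := fun y => by
    let d : Fin k → Fin Q := Function.extend s (y - x) 0
    have hd : ∀ j, d (s j) = y j - x j := fun j => by
      simp [d, hs.extend_apply]
    rw [← Equiv.sum_comp (Equiv.addRight d)]
    refine Finset.sum_congr rfl fun q _ => ?_
    have h1 : ((q + d) ∘ s = y) ↔ (q ∘ s = x) := by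
      simp only [funext_iff, Function.comp_apply, Pi.add_apply, hd]
      refine forall_congr' fun j => ⟨fun h => ?_, fun h => ?_⟩
      · rw [← add_sub_assoc, sub_eq_iff_eq_add, add_comm] at h
        exact add_left_cancel h
      · rw [h]; abel
    have h2 : U (q + d) = U q := hU _ _ fun i hi => by
      have : d i = 0 := Function.extend_apply' _ _ _ hi
      simp [this]
    simp only [Equiv.coe_addRight, h1, h2]
  have htot : ∑ y : Fin k' → Fin Q, ∑ q, (if q ∘ s = y then U q else 0) = ∑ q, U q := by
    rw [Finset.sum_comm]
    simp
  rw [Finset.sum_congr rfl fun y _ => hconst y] at htot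
  simp only [Finset.sum_const, Finset.card_univ, Fintype.card_pi, Fintype.card_fin,
    Finset.prod_const, nsmul_eq_mul, Nat.cast_pow] at htot
  have : (Q : ℝ) ^ k' ≠ 0 := by positivity
  rw [← htot, inv_mul_cancel_left₀ this]

section Player

variable {K Q k : ℕ}

/-- The branch of `ψ` in which the answer registers are measured to `r` in the Fourier basis. -/
noncomputable def fourierBranch (ψ : (Fin k → Fin Q) → (Fin k → Fin K) → ℂ)
    (r : Fin k → Fin K) (q : Fin k → Fin Q) : ℂ :=
  (fourierMatrix K k).mulVec (ψ q) r

/-- The part of the branch `r` accepted by the uniformity test; zero if `r` itself is rejected. -/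
noncomputable def acceptedBranch (η : ℝ) (ψ : (Fin k → Fin Q) → (Fin k → Fin K) → ℂ)
    (r : Fin k → Fin K) (q : Fin k → Fin Q) : ℂ :=
  if ((1 - η) / (K : ℝ) * k ≤ ((Finset.univ.filter fun i => (r i : ℕ) = 0).card : ℝ)) then
    (unifProj K Q k r).mulVec (fourierBranch ψ r) q
  else 0

lemma sum_normSq_fourierBranch (hK : 0 < K) (ψ : (Fin k → Fin Q) → (Fin k → Fin K) → ℂ)
    (q : Fin k → Fin Q) :
    ∑ r, Complex.normSq (fourierBranch ψ r q) = ∑ a, Complex.normSq (ψ q a) :=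
  sum_normSq_mulVec_of_isometry (fourierMatrix_isometry K k hK) (ψ q)

lemma sum_normSq_acceptedBranch (hQ : 0 < Q) (η : ℝ)
    (ψ : (Fin k → Fin Q) → (Fin k → Fin K) → ℂ) :
    ∑ r, ∑ q, Complex.normSq (acceptedBranch η ψ r q) = unifPassProb K Q k η ψ := by
  refine Finset.sum_congr rfl fun r _ => ?_
  simp only [acceptedBranch]
  split_ifs
  · simp only [unifOverlap_eq]
    exact sum_normSq_mulVec_of_partialIsometry (testMatrix_mul K Q k hQ r)
      (unifProj_mul_self K Q k hQ r) _
  · simp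

lemma sum_normSq_sub_acceptedBranch (hK : 0 < K) (hQ : 0 < Q) (η : ℝ)
    (ψ : (Fin k → Fin Q) → (Fin k → Fin K) → ℂ) :
    ∑ r, ∑ q, Complex.normSq (fourierBranch ψ r q - acceptedBranch η ψ r q) =
      ∑ q, ∑ a, Complex.normSq (ψ q a) - unifPassProb K Q k η ψ := by
  have h1 : ∑ q, ∑ a, Complex.normSq (ψ q a) =
      ∑ r, ∑ q, Complex.normSq (fourierBranch ψ r q) := by
    symm
    rw [Finset.sum_comm]
    exact Finset.sum_congr rfl fun q _ => sum_normSq_fourierBranch hK ψ q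
  rw [h1, unifPassProb, ← Finset.sum_sub_distrib]
  refine Finset.sum_congr rfl fun r _ => ?_
  simp only [acceptedBranch]
  split_ifs
  · simp only [unifOverlap_eq]
    exact sum_normSq_sub_mulVec_of_partialIsometry (testMatrix_mul K Q k hQ r)
      (unifProj_mul_self K Q k hQ r) _
  · simp

lemma unifPassProb_nonneg (η : ℝ) (ψ : (Fin k → Fin Q) → (Fin k → Fin K) → ℂ) :
    0 ≤ unifPassProb K Q k η ψ := by
  refine Finset.sum_nonneg fun r _ => ?_
  split_ifs
  · exact Finset.sum_nonneg fun _ _ => Complex.normSq_nonneg _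
  · exact le_rfl

lemma unifPassProb_le (hK : 0 < K) (hQ : 0 < Q) (η : ℝ)
    (ψ : (Fin k → Fin Q) → (Fin k → Fin K) → ℂ) :
    unifPassProb K Q k η ψ ≤ ∑ q, ∑ a, Complex.normSq (ψ q a) := by
  rw [← sub_nonneg, ← sum_normSq_sub_acceptedBranch hK hQ]
  exact Finset.sum_nonneg fun _ _ => Finset.sum_nonneg fun _ _ => Complex.normSq_nonneg _

/-- For every outcome `r` there are `k'` registers on which the accepted branch is uniform. -/
lemma exists_uniform_registers {k' : ℕ} (η : ℝ) (hk : k' ≤ k)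
    (hk' : (k' : ℝ) ≤ (1 - η) / (K : ℝ) * k) (ψ : (Fin k → Fin Q) → (Fin k → Fin K) → ℂ)
    (r : Fin k → Fin K) :
    ∃ s : Fin k' → Fin k, Function.Injective s ∧ ∀ q q' : Fin k → Fin Q,
      (∀ i, i ∉ Set.range s → q i = q' i) → acceptedBranch η ψ r q = acceptedBranch η ψ r q' := by
  by_cases h : (1 - η) / (K : ℝ) * k ≤
      ((Finset.univ.filter fun i => (r i : ℕ) = 0).card : ℝ)
  · have hcard : k' ≤ (Finset.univ.filter fun i => (r i : ℕ) = 0).card := by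
      exact_mod_cast hk'.trans h
    obtain ⟨t, ht, hc⟩ := Finset.exists_subset_card_eq hcard
    refine ⟨t.orderEmbOfFin hc, (t.orderEmbOfFin hc).injective, fun q q' hq => ?_⟩
    simp only [acceptedBranch, if_pos h]
    refine unifProj_mulVec_congr K Q k r _ fun i hi => hq i ?_
    rw [Finset.range_orderEmbOfFin]
    intro hmem
    exact hi (Finset.mem_filter.1 (ht hmem)).2
  · exact ⟨Fin.castLE hk, Fin.castLE_injective hk, fun q q' _ => by simp [acceptedBranch, h]⟩

/-- A state passing the uniformity test with high probability has measurement statistics close to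
those of a (sub-normalised) classical process which draws an outcome `r`, plants uniformly random
questions into the `k'` registers `s r`, and answers. -/
lemma exists_classical_process {k' : ℕ} (hK : 0 < K) (hQ : 0 < Q) (η : ℝ) (hk : k' ≤ k)
    (hk' : (k' : ℝ) ≤ (1 - η) / (K : ℝ) * k) (ψ : (Fin k → Fin Q) → (Fin k → Fin K) → ℂ)
    (hψ : ∑ q, ∑ a, Complex.normSq (ψ q a) = 1) (δ : ℝ)
    (hδ : 1 - δ ≤ unifPassProb K Q k η ψ) :
    ∃ (M : (Fin k → Fin K) → (Fin k → Fin Q) → (Fin k → Fin K) → ℝ)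
      (s : (Fin k → Fin K) → Fin k' → Fin k),
      (∀ r q a, 0 ≤ M r q a) ∧
      (∀ x, ∑ r, ∑ q, (if q ∘ s r = x then ∑ a, M r q a else 0) ≤ ((Q : ℝ) ^ k')⁻¹) ∧
      ∀ T : (Fin k → Fin Q) → (Fin k → Fin K) → ℝ, (∀ q a, 0 ≤ T q a) → (∀ q a, T q a ≤ 1) →
        ∑ q, ∑ a, Complex.normSq (ψ q a) * T q a - 2 * √δ ≤
          ∑ r, ∑ q, ∑ a, M r q a * T q a := by
  choose s hs hU using exists_uniform_registers η hk hk' ψ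
  set V := acceptedBranch η ψ with hV
  set P : (Fin k → Fin Q) → ℝ := fun q => ∑ a, Complex.normSq (ψ q a) with hP
  have hP0 : ∀ q, 0 ≤ P q := fun q => Finset.sum_nonneg fun _ _ => Complex.normSq_nonneg _
  have hV1 : ∑ r, ∑ q, Complex.normSq (V r q) ≤ 1 := by
    rw [hV, sum_normSq_acceptedBranch hQ, ← hψ]
    exact unifPassProb_le hK hQ η ψ
  refine ⟨fun r q a => Complex.normSq (V r q) * (Complex.normSq (ψ q a) / P q), s,
    fun r q a => mul_nonneg (Complex.normSq_nonneg _)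
      (div_nonneg (Complex.normSq_nonneg _) (hP0 q)), fun x => ?_, fun T hT0 hT1 => ?_⟩
  · have hle : ∀ r q, ∑ a, Complex.normSq (V r q) * (Complex.normSq (ψ q a) / P q) ≤
        Complex.normSq (V r q) := fun r q => by
      rw [← Finset.mul_sum, ← Finset.sum_div]
      exact mul_le_of_le_one_right (Complex.normSq_nonneg _) (div_self_le_one (P q))
    calc _ ≤ ∑ r, ∑ q, (if q ∘ s r = x then Complex.normSq (V r q) else 0) := by
          refine Finset.sum_le_sum fun r _ => Finset.sum_le_sum fun q _ => ?_
          split_ifs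
          · exact hle r q
          · exact le_rfl
      _ = ∑ r, ((Q : ℝ) ^ k')⁻¹ * ∑ q, Complex.normSq (V r q) := by
          refine Finset.sum_congr rfl fun r _ => ?_
          exact sum_fiber_eq hQ (s r) (hs r) _ (fun q q' h => by rw [hU r q q' h]) x
      _ ≤ _ := by
          rw [← Finset.mul_sum]
          exact mul_le_of_le_one_right (by positivity) hV1
  · set τ : (Fin k → Fin Q) → ℝ := fun q => (∑ a, Complex.normSq (ψ q a) * T q a) / P q with hτ
    have hnum : ∀ q, ∑ a, Complex.normSq (ψ q a) * T q a ≤ P q := fun q =>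
      Finset.sum_le_sum fun a _ => mul_le_of_le_one_right (Complex.normSq_nonneg _) (hT1 q a)
    have hnum0 : ∀ q, 0 ≤ ∑ a, Complex.normSq (ψ q a) * T q a := fun q =>
      Finset.sum_nonneg fun a _ => mul_nonneg (Complex.normSq_nonneg _) (hT0 q a)
    have hτ0 : ∀ q, 0 ≤ τ q := fun q => div_nonneg (hnum0 q) (hP0 q)
    have hτ1 : ∀ q, τ q ≤ 1 := fun q => div_le_one_of_le₀ (hnum q) (hP0 q)
    have hPτ : ∀ q, P q * τ q = ∑ a, Complex.normSq (ψ q a) * T q a := fun q => by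
      by_cases h : P q = 0
      · have := hnum q
        rw [h] at this ⊢
        rw [le_antisymm this (hnum0 q)]
        simp
      · exact mul_div_cancel₀ _ h
    have hR : ∑ r, ∑ q, ∑ a, Complex.normSq (V r q) * (Complex.normSq (ψ q a) / P q) * T q a =
        ∑ r, ∑ q, Complex.normSq (V r q) * τ q := by
      refine Finset.sum_congr rfl fun r _ => Finset.sum_congr rfl fun q _ => ?_
      simp only [hτ]
      rw [Finset.sum_div, Finset.mul_sum]
      exact Finset.sum_congr rfl fun a _ => by ring
    have hL : ∑ q, ∑ a, Complex.normSq (ψ q a) * T q a =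
        ∑ r, ∑ q, Complex.normSq (fourierBranch ψ r q) * τ q := by
      symm
      rw [Finset.sum_comm]
      refine Finset.sum_congr rfl fun q _ => ?_
      rw [← Finset.sum_mul, sum_normSq_fourierBranch hK]
      exact hPτ q
    have hd : ∑ r, ∑ q, |Complex.normSq (fourierBranch ψ r q) - Complex.normSq (V r q)| ≤
        2 * √δ := by
      have h := sum_abs_normSq_sub_le
        (fun p : (Fin k → Fin K) × (Fin k → Fin Q) => fourierBranch ψ p.1 p.2)
        (fun p => V p.1 p.2) ?_ ?_
      · simp only [Fintype.sum_prod_type] at h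
        refine h.trans ?_
        rw [hV, sum_normSq_sub_acceptedBranch hK hQ, hψ]
        gcongr
        linarith
      · rw [Fintype.sum_prod_type, Finset.sum_comm]
        simp only [sum_normSq_fourierBranch hK]
        exact hψ.le
      · rw [Fintype.sum_prod_type]
        exact hV1
    rw [hR, hL, sub_le_iff_le_add', ← sub_le_iff_le_add, ← Finset.sum_sub_distrib]
    refine le_trans (Finset.sum_le_sum fun r _ => ?_) hd
    rw [← Finset.sum_sub_distrib]
    refine Finset.sum_le_sum fun q _ => ?_
    rw [← sub_mul]
    calc _ ≤ |Complex.normSq (fourierBranch ψ r q) - Complex.normSq (V r q)| * τ q :=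
          mul_le_mul_of_nonneg_right (le_abs_self _) (hτ0 q)
      _ ≤ _ := mul_le_of_le_one_right (abs_nonneg _) (hτ1 q)

end Player

/-- Nonnegative weights of total mass at most one have a best response. -/
lemma exists_best_response {Y B : Type*} [Fintype B] [Nonempty B]
    (κ h : Y → B → ℝ) (hκ : ∀ y b, 0 ≤ κ y b) (hκ1 : ∀ y, ∑ b, κ y b ≤ 1)
    (hh : ∀ y b, 0 ≤ h y b) :
    ∃ g : Y → B, ∀ y, ∑ b, κ y b * h y b ≤ h y (g y) := by
  choose g hg using fun y => Finite.exists_max (h y)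
  refine ⟨g, fun y => ?_⟩
  calc ∑ b, κ y b * h y b ≤ ∑ b, κ y b * h y (g y) :=
        Finset.sum_le_sum fun b _ => mul_le_mul_of_nonneg_left (hg y b) (hκ y b)
    _ = (∑ b, κ y b) * h y (g y) := (Finset.sum_mul _ _ _).symm
    _ ≤ h y (g y) := mul_le_of_le_one_left (hh _ _) (hκ1 y)

/-- Rounding of local stochastic behaviours to deterministic strategies. The weights `w₁`, `w₂`
on `X × A` and `Y × B` include the uniform distribution of the questions. -/
lemma exists_stratValue_ge {X Y A B : Type*} [Fintype X] [Fintype Y] [Fintype A] [Fintype B]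
    [Nonempty X] [Nonempty Y] [Nonempty A] [Nonempty B] (D : X → Y → A → B → Prop)
    (w₁ : X → A → ℝ) (w₂ : Y → B → ℝ)
    (h₁ : ∀ x a, 0 ≤ w₁ x a) (h₂ : ∀ y b, 0 ≤ w₂ y b)
    (hs₁ : ∀ x, ∑ a, w₁ x a ≤ (Fintype.card X : ℝ)⁻¹)
    (hs₂ : ∀ y, ∑ b, w₂ y b ≤ (Fintype.card Y : ℝ)⁻¹) :
    ∃ (f : X → A) (g : Y → B),
      ∑ x, ∑ a, w₁ x a * ∑ y, ∑ b, w₂ y b * (if D x y a b then (1 : ℝ) else 0) ≤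
        stratValue (uniformPair X Y) D f g := by
  have hX : (0 : ℝ) < Fintype.card X := by exact_mod_cast Fintype.card_pos
  have hY : (0 : ℝ) < Fintype.card Y := by exact_mod_cast Fintype.card_pos
  obtain ⟨f, hf⟩ := exists_best_response (fun x a => Fintype.card X * w₁ x a)
    (fun x a => ∑ y, ∑ b, w₂ y b * (if D x y a b then (1 : ℝ) else 0))
    (fun x a => mul_nonneg hX.le (h₁ x a))
    (fun x => by
      rw [← Finset.mul_sum]
      exact (mul_le_mul_of_nonneg_left (hs₁ x) hX.le).trans_eq (mul_inv_cancel₀ hX.ne'))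
    (fun x a => Finset.sum_nonneg fun y _ => Finset.sum_nonneg fun b _ =>
      mul_nonneg (h₂ y b) (by positivity))
  obtain ⟨g, hg⟩ := exists_best_response (fun y b => Fintype.card Y * w₂ y b)
    (fun y b => ∑ x, (if D x y (f x) b then (1 : ℝ) else 0))
    (fun y b => mul_nonneg hY.le (h₂ y b))
    (fun y => by
      rw [← Finset.mul_sum]
      exact (mul_le_mul_of_nonneg_left (hs₂ y) hY.le).trans_eq (mul_inv_cancel₀ hY.ne'))
    (fun y b => Finset.sum_nonneg fun x _ => by positivity)
  refine ⟨f, g, ?_⟩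
  have e1 : ∑ x, ∑ a, w₁ x a * ∑ y, ∑ b, w₂ y b * (if D x y a b then (1 : ℝ) else 0) ≤
      (Fintype.card X : ℝ)⁻¹ *
        ∑ x, ∑ y, ∑ b, w₂ y b * (if D x y (f x) b then (1 : ℝ) else 0) := by
    rw [Finset.mul_sum]
    refine Finset.sum_le_sum fun x _ => ?_
    have := hf x
    simp only [mul_assoc, ← Finset.mul_sum] at this
    rw [inv_mul_eq_div, le_div_iff₀ hX, mul_comm]
    simpa only [Finset.mul_sum] using this
  have e2 : ∑ x, ∑ y, ∑ b, w₂ y b * (if D x y (f x) b then (1 : ℝ) else 0) ≤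
      (Fintype.card Y : ℝ)⁻¹ * ∑ y, ∑ x, (if D x y (f x) (g y) then (1 : ℝ) else 0) := by
    rw [Finset.sum_comm, Finset.mul_sum]
    refine Finset.sum_le_sum fun y _ => ?_
    have := hg y
    simp only [mul_assoc, ← Finset.mul_sum] at this
    rw [Finset.sum_comm, inv_mul_eq_div, le_div_iff₀ hY, mul_comm]
    simpa only [Finset.mul_sum] using this
  refine e1.trans ((mul_le_mul_of_nonneg_left e2 (inv_nonneg.2 hX.le)).trans_eq ?_)
  rw [stratValue, Finset.sum_comm]
  simp only [uniformPair, ← Finset.mul_sum, mul_inv, mul_assoc]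

lemma consisAccept.comp {n m K k k' : ℕ} {ends : Fin m → Fin n × Fin n}
    {R : Fin m → Fin K → Fin K → Bool} {qA : Fin k → Fin m} {qB : Fin k → Fin n}
    {aA : Fin k → Fin K × Fin K} {aB : Fin k → Fin K}
    (h : consisAccept ends R qA qB aA aB) (s t : Fin k' → Fin k) :
    consisAccept ends R (qA ∘ s) (qB ∘ t) (aA ∘ s) (aB ∘ t) :=
  fun i j => h (s i) (t j)

lemma sum_fiber_mul {ι X A : Type*} [Fintype ι] [Fintype X] [Fintype A]
    [DecidableEq X] [DecidableEq A] (M : ι → ℝ) (ξ : ι → X) (ζ : ι → A) (F : X → A → ℝ) :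
    ∑ x, ∑ a, (∑ p, if ξ p = x ∧ ζ p = a then M p else 0) * F x a =
      ∑ p, M p * F (ξ p) (ζ p) := by
  have h : ∀ p, ∑ x, ∑ a, (if ξ p = x ∧ ζ p = a then M p else 0) * F x a =
      M p * F (ξ p) (ζ p) := fun p => by
    simp [ite_and, ite_mul]
  simp only [Finset.sum_mul]
  rw [Finset.sum_congr rfl fun x _ => Finset.sum_comm, Finset.sum_comm]
  exact Finset.sum_congr rfl fun p _ => h p

/-- Rounding of classical processes producing questions and answers, whose question marginals are
dominated by the uniform distribution, to deterministic strategies. -/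
lemma exists_stratValue_ge_of_process {ι κ X Y A B : Type*} [Fintype ι] [Fintype κ] [Fintype X]
    [Fintype Y] [Fintype A] [Fintype B] [Nonempty X] [Nonempty Y] [Nonempty A] [Nonempty B]
    [DecidableEq X] [DecidableEq Y]
    (D : X → Y → A → B → Prop) (M₁ : ι → ℝ) (M₂ : κ → ℝ) (ξ₁ : ι → X) (ζ₁ : ι → A)
    (ξ₂ : κ → Y) (ζ₂ : κ → B) (h₁ : ∀ p, 0 ≤ M₁ p) (h₂ : ∀ p, 0 ≤ M₂ p)
    (hs₁ : ∀ x, ∑ p, (if ξ₁ p = x then M₁ p else 0) ≤ (Fintype.card X : ℝ)⁻¹)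
    (hs₂ : ∀ y, ∑ p, (if ξ₂ p = y then M₂ p else 0) ≤ (Fintype.card Y : ℝ)⁻¹) :
    ∃ (f : X → A) (g : Y → B),
      ∑ p, M₁ p * ∑ p', M₂ p' * (if D (ξ₁ p) (ξ₂ p') (ζ₁ p) (ζ₂ p') then (1 : ℝ) else 0) ≤
        stratValue (uniformPair X Y) D f g := by
  obtain ⟨f, g, h⟩ := exists_stratValue_ge D
    (fun x a => ∑ p, if ξ₁ p = x ∧ ζ₁ p = a then M₁ p else 0)
    (fun y b => ∑ p, if ξ₂ p = y ∧ ζ₂ p = b then M₂ p else 0)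
    (fun x a => Finset.sum_nonneg fun p _ => by split_ifs <;> simp [h₁])
    (fun y b => Finset.sum_nonneg fun p _ => by split_ifs <;> simp [h₂])
    (fun x => by rw [Finset.sum_comm]; simpa [ite_and] using hs₁ x)
    (fun y => by rw [Finset.sum_comm]; simpa [ite_and] using hs₂ y)
  refine ⟨f, g, le_trans (le_of_eq ?_) h⟩
  simp only [sum_fiber_mul]

lemma stratValue_nonneg {X Y A B : Type*} [Fintype X] [Fintype Y] (D : X → Y → A → B → Prop)
    (f : X → A) (g : Y → B) : 0 ≤ stratValue (uniformPair X Y) D f g := by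
  unfold stratValue uniformPair
  positivity

lemma sum_le_one_of_fiber_le {ι X : Type*} [Fintype ι] [Fintype X] [Nonempty X]
    [DecidableEq X] (M : ι → ℝ) (ξ : ι → X)
    (h : ∀ x, ∑ p, (if ξ p = x then M p else 0) ≤ (Fintype.card X : ℝ)⁻¹) :
    ∑ p, M p ≤ 1 := by
  have h1 : ∑ x, ∑ p, (if ξ p = x then M p else 0) = ∑ p, M p := by
    rw [Finset.sum_comm]; simp
  rw [← h1]
  refine (Finset.sum_le_sum fun x _ => h x).trans ?_
  simp

lemma protoConsisPassProb_le {n m K k : ℕ} (ends : Fin m → Fin n × Fin n)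
    (R : Fin m → Fin K → Fin K → Bool)
    (ψ1 : (Fin k → Fin m) → (Fin k → Fin (K * K)) → ℂ)
    (ψ2 : (Fin k → Fin n) → (Fin k → Fin K) → ℂ) :
    protoConsisPassProb ends R ψ1 ψ2 ≤
      (∑ q, ∑ a, Complex.normSq (ψ1 q a)) * ∑ q, ∑ a, Complex.normSq (ψ2 q a) := by
  simp only [protoConsisPassProb, Finset.sum_mul]
  refine Finset.sum_le_sum fun qA _ => Finset.sum_le_sum fun aA _ => ?_
  simp only [Finset.mul_sum]
  refine Finset.sum_le_sum fun qB _ => Finset.sum_le_sum fun aB _ => ?_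
  refine mul_le_mul_of_nonneg_right ?_ (Complex.normSq_nonneg _)
  refine mul_le_of_le_one_left (Complex.normSq_nonneg _) ?_
  split_ifs <;> norm_num

/-- Deterministic strategies for the consistency game extracted from accepted states. -/
lemma exists_deterministic_strategy {n m K : ℕ} (hn : 0 < n) (hm : 0 < m) (hK : 0 < K)
    {η : ℝ} (hη0 : 0 < η) (hη1 : η < 1) {k k' : ℕ}
    (hk' : (k' : ℝ) = ((k : ℝ) / ((K : ℝ) ^ 2)) * (1 - η))
    (ends : Fin m → Fin n × Fin n) (R : Fin m → Fin K → Fin K → Bool)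
    (ψ1 : (Fin k → Fin m) → (Fin k → Fin (K * K)) → ℂ)
    (ψ2 : (Fin k → Fin n) → (Fin k → Fin K) → ℂ)
    (hψ1 : ∑ q : Fin k → Fin m, ∑ a : Fin k → Fin (K * K), Complex.normSq (ψ1 q a) = 1)
    (hψ2 : ∑ q : Fin k → Fin n, ∑ a : Fin k → Fin K, Complex.normSq (ψ2 q a) = 1)
    {ε : ℝ} (hacc : 1 - ε ≤ protocolAcceptProb n m K k η ends R ψ1 ψ2) :
    ∃ (f : (Fin k' → Fin m) → Fin k' → Fin K × Fin K) (g : (Fin k' → Fin n) → Fin k' → Fin K),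
      1 - 2 * ε - 4 * √(2 * ε) ≤ stratValue (uniformPair (Fin k' → Fin m) (Fin k' → Fin n))
        (consisAccept (n := n) (m := m) (K := K) (k := k') (l := k') ends R) f g := by
  have : Nonempty (Fin n) := ⟨⟨0, hn⟩⟩
  have : Nonempty (Fin m) := ⟨⟨0, hm⟩⟩
  have : Nonempty (Fin K) := ⟨⟨0, hK⟩⟩
  have hK1 : (1 : ℝ) ≤ K := by exact_mod_cast hK
  have hKB : (k' : ℝ) ≤ (1 - η) / (K : ℝ) * k := by
    rw [hk', div_mul_eq_mul_div, div_mul_eq_mul_div, mul_comm (k : ℝ)]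
    have : (K : ℝ) ≤ K ^ 2 := le_self_pow₀ hK1 (by norm_num)
    have : 0 ≤ (1 - η) * k := mul_nonneg (by linarith) (Nat.cast_nonneg k)
    gcongr
  have hKA : (k' : ℝ) ≤ (1 - η) / ((K * K : ℕ) : ℝ) * k := by
    rw [hk']
    push_cast
    exact le_of_eq (by ring)
  have hkk : k' ≤ k := by
    have : (1 - η) / (K : ℝ) ≤ 1 := div_le_one_of_le₀ (by linarith) (by linarith)
    exact_mod_cast hKB.trans (mul_le_of_le_one_left (Nat.cast_nonneg k) this)
  have hKK : 0 < K * K := Nat.mul_pos hK hK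
  have hp1 := unifPassProb_nonneg η ψ1
  have hp2 := unifPassProb_nonneg η ψ2
  have hp1' := unifPassProb_le hKK hm η ψ1
  have hp2' := unifPassProb_le hK hn η ψ2
  have hc := protoConsisPassProb_le ends R ψ1 ψ2
  rw [hψ1] at hp1'
  rw [hψ2] at hp2'
  rw [hψ1, hψ2, mul_one] at hc
  unfold protocolAcceptProb at hacc
  have hA : 1 - 2 * ε ≤ unifPassProb (K * K) m k η ψ1 := by
    nlinarith [mul_le_of_le_one_right hp1 hp2']
  have hB : 1 - 2 * ε ≤ unifPassProb K n k η ψ2 := by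
    nlinarith [mul_le_of_le_one_left hp2 hp1']
  have hC : 1 - 2 * ε ≤ protoConsisPassProb ends R ψ1 ψ2 := by
    nlinarith [mul_le_of_le_one_left hp2 hp1']
  obtain ⟨M₁, s₁, hM₁, hx₁, hT₁⟩ := exists_classical_process hKK hm η hkk hKA ψ1 hψ1 _ hA
  obtain ⟨M₂, s₂, hM₂, hx₂, hT₂⟩ := exists_classical_process hK hn η hkk hKB ψ2 hψ2 _ hB
  let dec : (Fin k → Fin (K * K)) → Fin k → Fin K × Fin K :=
    fun a i => finProdFinEquiv.symm (a i)
  have hm₁ : ∀ x : Fin k' → Fin m,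
      ∑ p : (Fin k → Fin (K * K)) × (Fin k → Fin m) × (Fin k → Fin (K * K)),
        (if p.2.1 ∘ s₁ p.1 = x then M₁ p.1 p.2.1 p.2.2 else 0) ≤
          (Fintype.card (Fin k' → Fin m) : ℝ)⁻¹ := fun x => by
    refine le_trans (le_of_eq ?_) ((hx₁ x).trans_eq (by simp))
    simp only [Fintype.sum_prod_type, Finset.sum_ite_irrel, Finset.sum_const_zero]
  have hm₂ : ∀ y : Fin k' → Fin n,
      ∑ p : (Fin k → Fin K) × (Fin k → Fin n) × (Fin k → Fin K),
        (if p.2.1 ∘ s₂ p.1 = y then M₂ p.1 p.2.1 p.2.2 else 0) ≤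
          (Fintype.card (Fin k' → Fin n) : ℝ)⁻¹ := fun y => by
    refine le_trans (le_of_eq ?_) ((hx₂ y).trans_eq (by simp))
    simp only [Fintype.sum_prod_type, Finset.sum_ite_irrel, Finset.sum_const_zero]
  obtain ⟨f, g, hfg⟩ := exists_stratValue_ge_of_process
    (consisAccept (n := n) (m := m) (K := K) (k := k') (l := k') ends R)
    (fun p : (Fin k → Fin (K * K)) × (Fin k → Fin m) × (Fin k → Fin (K * K)) =>
      M₁ p.1 p.2.1 p.2.2)
    (fun p : (Fin k → Fin K) × (Fin k → Fin n) × (Fin k → Fin K) => M₂ p.1 p.2.1 p.2.2)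
    (fun p => p.2.1 ∘ s₁ p.1) (fun p => dec p.2.2 ∘ s₁ p.1)
    (fun p => p.2.1 ∘ s₂ p.1) (fun p => p.2.2 ∘ s₂ p.1)
    (fun p => hM₁ _ _ _) (fun p => hM₂ _ _ _) hm₁ hm₂
  refine ⟨f, g, le_trans ?_ hfg⟩
  set T : (Fin k → Fin m) → (Fin k → Fin (K * K)) → (Fin k → Fin n) → (Fin k → Fin K) → ℝ :=
    fun qA aA qB aB => if consisAccept ends R qA qB (dec aA) aB then 1 else 0 with hT
  have hT0 : ∀ qA aA qB aB, 0 ≤ T qA aA qB aB := fun _ _ _ _ => by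
    simp only [hT]; positivity
  have hT1 : ∀ qA aA qB aB, T qA aA qB aB ≤ 1 := fun _ _ _ _ => by
    simp only [hT]; split_ifs <;> norm_num
  -- The averages of `T` over Bob's measurement outcomes.
  set S : (Fin k → Fin m) → (Fin k → Fin (K * K)) → ℝ :=
    fun qA aA => ∑ qB, ∑ aB, Complex.normSq (ψ2 qB aB) * T qA aA qB aB with hS
  have hS0 : ∀ qA aA, 0 ≤ S qA aA := fun qA aA => Finset.sum_nonneg fun _ _ =>
    Finset.sum_nonneg fun _ _ => mul_nonneg (Complex.normSq_nonneg _) (hT0 _ _ _ _)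
  have hS1 : ∀ qA aA, S qA aA ≤ 1 := fun qA aA => by
    rw [← hψ2]
    exact Finset.sum_le_sum fun _ _ => Finset.sum_le_sum fun _ _ =>
      mul_le_of_le_one_right (Complex.normSq_nonneg _) (hT1 _ _ _ _)
  have hCS : protoConsisPassProb ends R ψ1 ψ2 =
      ∑ qA, ∑ aA, Complex.normSq (ψ1 qA aA) * S qA aA := by
    simp only [protoConsisPassProb, hS, hT, Finset.mul_sum]
    refine Finset.sum_congr rfl fun qA _ => Finset.sum_congr rfl fun aA _ =>
      Finset.sum_congr rfl fun qB _ => Finset.sum_congr rfl fun aB _ => ?_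
    ring
  have hfirst := hT₁ S hS0 hS1
  rw [← hCS] at hfirst
  have hmass := sum_le_one_of_fiber_le _ _ hm₁
  have hsecond : ∑ r, ∑ q, ∑ a, M₁ r q a * S q a - 2 * √(2 * ε) ≤
      ∑ p : (Fin k → Fin (K * K)) × (Fin k → Fin m) × (Fin k → Fin (K * K)),
        M₁ p.1 p.2.1 p.2.2 * (S p.2.1 p.2.2 - 2 * √(2 * ε)) := by
    simp only [mul_sub, Finset.sum_sub_distrib, ← Finset.sum_mul]
    rw [Fintype.sum_prod_type]
    simp only [Fintype.sum_prod_type] at hmass ⊢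
    have : (∑ r, ∑ q, ∑ a, M₁ r q a) * (2 * √(2 * ε)) ≤ 2 * √(2 * ε) :=
      mul_le_of_le_one_left (by positivity) hmass
    linarith
  have hthird : ∑ p : (Fin k → Fin (K * K)) × (Fin k → Fin m) × (Fin k → Fin (K * K)),
        M₁ p.1 p.2.1 p.2.2 * (S p.2.1 p.2.2 - 2 * √(2 * ε)) ≤
      ∑ p : (Fin k → Fin (K * K)) × (Fin k → Fin m) × (Fin k → Fin (K * K)),
        M₁ p.1 p.2.1 p.2.2 * ∑ p' : (Fin k → Fin K) × (Fin k → Fin n) × (Fin k → Fin K),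
          M₂ p'.1 p'.2.1 p'.2.2 * (if consisAccept ends R (p.2.1 ∘ s₁ p.1) (p'.2.1 ∘ s₂ p'.1)
            (dec p.2.2 ∘ s₁ p.1) (p'.2.2 ∘ s₂ p'.1) then (1 : ℝ) else 0) := by
    refine Finset.sum_le_sum fun p _ => mul_le_mul_of_nonneg_left ?_ (hM₁ _ _ _)
    refine (hT₂ (T p.2.1 p.2.2) (hT0 _ _) (hT1 _ _)).trans ?_
    simp only [Fintype.sum_prod_type]
    refine Finset.sum_le_sum fun r _ => Finset.sum_le_sum fun q _ => Finset.sum_le_sum fun a _ =>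
      mul_le_mul_of_nonneg_left ?_ (hM₂ _ _ _)
    simp only [hT]
    split_ifs with h h'
    · exact le_rfl
    · exact absurd (h.comp (s₁ p.1) (s₂ r)) h'
    · exact zero_le_one
    · exact le_rfl
  refine le_trans ?_ hthird
  linarith

/-- soundness of the BellQMA(2) protocol, reduction to the consistency game.
There is a universal constant `C` such that if a pair of states `ψ1, ψ2` is accepted in the
BellQMA(2) protocol for `(𝒢, K, R)` with probability at least `1 - ε`, then there is a
randomized classical strategy for the consistency game `G^{k',k'}(𝒢,K,R)`, where
`k' = (k/K²)(1-η)`, achieving value at least `1 - C·ε^{1/4}`. -/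
theorem bellqma_soundness_reduction :
    ∃ C : ℝ, 0 < C ∧
      ∀ (n m K : ℕ), 0 < n → 0 < m → 0 < K →
      ∀ (η : ℝ), 0 < η → η < 1 →
      ∀ (k k' : ℕ), (k' : ℝ) = ((k : ℝ) / ((K : ℝ) ^ 2)) * (1 - η) →
      ∀ (ends : Fin m → Fin n × Fin n) (R : Fin m → Fin K → Fin K → Bool)
        (ψ1 : (Fin k → Fin m) → (Fin k → Fin (K * K)) → ℂ)
        (ψ2 : (Fin k → Fin n) → (Fin k → Fin K) → ℂ),
        (∑ q : Fin k → Fin m, ∑ a : Fin k → Fin (K * K), Complex.normSq (ψ1 q a) = 1) →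
        (∑ q : Fin k → Fin n, ∑ a : Fin k → Fin K, Complex.normSq (ψ2 q a) = 1) →
      ∀ (ε : ℝ), 0 ≤ ε →
        1 - ε ≤ protocolAcceptProb n m K k η ends R ψ1 ψ2 →
        ∃ π : (((Fin k' → Fin m) → Fin k' → Fin K × Fin K) ×
               ((Fin k' → Fin n) → Fin k' → Fin K)) → ℝ,
          (∀ s, 0 ≤ π s) ∧ (∑ s, π s = 1) ∧
          1 - C * ε ^ ((1 : ℝ) / 4) ≤
            ∑ s, π s *
              stratValue (uniformPair (Fin k' → Fin m) (Fin k' → Fin n))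
                (consisAccept (n := n) (m := m) (K := K) (k := k') (l := k') ends R)
                s.1 s.2 := by
  refine ⟨20, by norm_num, ?_⟩
  intro n m K hn hm hK η hη0 hη1 k k' hk' ends R ψ1 ψ2 hψ1 hψ2 ε hε hacc
  have : Nonempty (Fin n) := ⟨⟨0, hn⟩⟩
  have : Nonempty (Fin m) := ⟨⟨0, hm⟩⟩
  have : Nonempty (Fin K) := ⟨⟨0, hK⟩⟩
  obtain ⟨f, g, hfg⟩ : ∃ (f : (Fin k' → Fin m) → Fin k' → Fin K × Fin K)
      (g : (Fin k' → Fin n) → Fin k' → Fin K), 1 - 20 * ε ^ ((1 : ℝ) / 4) ≤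
        stratValue (uniformPair (Fin k' → Fin m) (Fin k' → Fin n))
          (consisAccept (n := n) (m := m) (K := K) (k := k') (l := k') ends R) f g := by
    rcases le_or_gt ε 1 with hε1 | hε1
    · obtain ⟨f, g, h⟩ := exists_deterministic_strategy hn hm hK hη0 hη1 hk' ends R ψ1 ψ2 hψ1 hψ2
        hacc
      refine ⟨f, g, le_trans ?_ h⟩
      have h1 : ε ≤ ε ^ ((1 : ℝ) / 4) := by
        conv_lhs => rw [← Real.rpow_one ε]
        exact Real.rpow_le_rpow_of_exponent_ge' hε hε1 (by norm_num) (by norm_num)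
      have h2 : √ε ≤ ε ^ ((1 : ℝ) / 4) := by
        rw [Real.sqrt_eq_rpow]
        exact Real.rpow_le_rpow_of_exponent_ge' hε hε1 (by norm_num) (by norm_num)
      have h3 : √(2 * ε) ≤ 2 * √ε := by
        rw [Real.sqrt_mul (by norm_num)]
        exact mul_le_mul_of_nonneg_right (by rw [Real.sqrt_le_iff]; norm_num) (Real.sqrt_nonneg ε)
      have h4 : 0 ≤ ε ^ ((1 : ℝ) / 4) := Real.rpow_nonneg hε _
      linarith
    · refine ⟨Classical.arbitrary _, Classical.arbitrary _, le_trans ?_ (stratValue_nonneg _ _ _)⟩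
      have := Real.one_le_rpow hε1.le (by norm_num : (0 : ℝ) ≤ 1 / 4)
      linarith
  refine ⟨fun s => if s = (f, g) then 1 else 0, fun s => by positivity, by simp, ?_⟩
  simpa using hfg
end
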